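/- There is a constant K such that the following holds for every n ≥ 4: if σ_1 and σ_2 are permutations of {1,…,n}, X is an ordered set of n literals, and S and T are disjoint sets of Tseitin variables none of whose variables occur in the CNF formula F or in X, then F ∧ Parity(X,S,σ_1) can be transformed into F ∧ Parity(X,T,σ_2) by a DRAT derivation with at most K·n·log n steps. -/

import Mathlib

abbrev Lit (ν : Type) := ν × Bool
abbrev Clause (ν : Type) := Finset (ν × Bool)
abbrev CNF (ν : Type) := Finset (Finset (ν × Bool))

variable {ν : Type} [DecidableEq ν]

/-- Negation of a literal. -/
def negLit (l : Lit ν) : Lit ν := (l.1, !l.2)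

/-- Canonical CNF encoding of the parity constraint `l₁ ⊕ ⋯ ⊕ l_k = c` for the
literals in the list `ls`: the clauses forbid exactly the assignments under which
the number of true literals among `ls` has parity different from `c`. -/
def parityCNF (ls : List (Lit ν)) (c : Bool) : CNF ν :=
  ((Finset.univ : Finset (Fin ls.length → Bool)).filter
      (fun f => (Finset.univ.filter (fun i => f i = true)).card % 2 = (if c then 0 else 1))).image
    (fun f => Finset.univ.image (fun i => if f i then negLit (ls.get i) else ls.get i))

/-- `xor(l₁,…,l_k)`: canonical CNF encoding of `l₁ ⊕ ⋯ ⊕ l_k = 0`. -/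
def xorCNF (ls : List (Lit ν)) : CNF ν := parityCNF ls false

def clauseSat (τ : ν → Bool) (C : Clause ν) : Prop := ∃ l ∈ C, τ l.1 = l.2

def cnfSat (τ : ν → Bool) (F : CNF ν) : Prop := ∀ C ∈ F, clauseSat τ C

def Unsat (F : CNF ν) : Prop := ¬ ∃ τ : ν → Bool, cnfSat τ F

def cnfVars (F : CNF ν) : Set ν := {v | ∃ C ∈ F, ∃ b, (v, b) ∈ C}

def clauseVars (C : Clause ν) : Set ν := {v | ∃ b, (v, b) ∈ C}

/-- `R` is the resolvent of `C` and `D`. -/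
def IsResolvent (C D R : Clause ν) : Prop :=
  ∃ v : ν, (v, true) ∈ C ∧ (v, false) ∈ D ∧ R = C.erase (v, true) ∪ D.erase (v, false)

/-- A resolution refutation of `F`: a sequence of clauses, each an axiom of `F` or a
resolvent of two earlier clauses, ending with the empty clause. Its length is `L.length`. -/
def IsResRefutation (F : CNF ν) (L : List (Clause ν)) : Prop :=
  L ≠ [] ∧ L.getLast? = some (∅ : Clause ν) ∧
    ∀ i, (hi : i < L.length) →
      L[i] ∈ F ∨ ∃ j k, ∃ (hj : j < i) (hk : k < i),
        IsResolvent (L[j]'(hj.trans hi)) (L[k]'(hk.trans hi)) L[i]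

/-- The `j`-th xor constraint (0-based) of `Parity(xs, t)`: for a list `xs` of `n ≥ 4`
literals and Tseitin variables `t 0, …, t (n-4)`, constraint `0` is
`xor(xs[0], xs[1], t 0)`, constraint `j` for `1 ≤ j ≤ n-4` is
`xor(t (j-1), xs[j+1], t j)`, and constraint `n-3` is `xor(t (n-4), xs[n-2], xs[n-1])`. -/
def parityCtr (xs : List (Lit ν)) (t : ℕ → ν) (j : ℕ) : List (Lit ν) :=
  if j = 0 then [xs.getD 0 (t 0, true), xs.getD 1 (t 0, true), (t 0, true)]
  else if j < xs.length - 3 then [(t (j - 1), true), xs.getD (j + 1) (t 0, true), (t j, true)]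
  else [(t (xs.length - 4), true), xs.getD (xs.length - 2) (t 0, true),
    xs.getD (xs.length - 1) (t 0, true)]

/-- The standard linear CNF encoding `Parity(xs, t)` of the parity constraint
`xs[0] ⊕ ⋯ ⊕ xs[n-1] = 0` using Tseitin variables `t 0, …, t (n-4)`. -/
def ParityCNF (xs : List (Lit ν)) (t : ℕ → ν) : CNF ν :=
  (Finset.range (xs.length - 2)).biUnion (fun j => xorCNF (parityCtr xs t j))

/-- The CNF `¬C` consisting of the unit clauses negating the literals of `C`. -/
def clauseNegCNF (C : Clause ν) : CNF ν := C.image (fun l => ({negLit l} : Clause ν))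

/-- One step of unit propagation: pick a unit clause `{l}` of `F`, resolve it with every
clause of `F` containing the negation of `l`, then remove `{l}`. -/
def UPStep (F F' : CNF ν) : Prop :=
  ∃ l : Lit ν, ({l} : Clause ν) ∈ F ∧
    F' = (F.erase {l}) ∪
      (F.filter (fun C => negLit l ∈ C)).image (fun C => C.erase (negLit l))

/-- `F ⊢₁ ⊥`: unit propagation from `F` derives the empty clause. -/
def UPRefutes (F : CNF ν) : Prop :=
  ∃ F', Relation.ReflTransGen UPStep F F' ∧ (∅ : Clause ν) ∈ F'

/-- `C` is an asymmetric tautology (AT) w.r.t. `F`: `F ∧ ¬C ⊢₁ ⊥`. -/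
def IsAT (F : CNF ν) (C : Clause ν) : Prop := UPRefutes (F ∪ clauseNegCNF C)

/-- `C` is a resolution asymmetric tautology (RAT) w.r.t. `F`. -/
def IsRAT (F : CNF ν) (C : Clause ν) : Prop :=
  ∃ l ∈ C, ∀ D ∈ F, negLit l ∈ D →
    UPRefutes (F ∪ clauseNegCNF (D.erase (negLit l)) ∪ clauseNegCNF C)

/-- A DRAT step: add a clause that is AT or RAT w.r.t. the current formula, or delete a
clause that is AT or RAT w.r.t. the remaining formula. -/
def DRATStep (F F' : CNF ν) : Prop :=
  (∃ C : Clause ν, (IsAT F C ∨ IsRAT F C) ∧ F' = insert C F) ∨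
  (∃ C ∈ F, (IsAT (F.erase C) C ∨ IsRAT (F.erase C) C) ∧ F' = F.erase C)

/-- A DRAT refutation of `F`: a sequence of formulas starting at `F`, linked by DRAT
steps, whose final formula contains the empty clause. Its number of lines is
`Fs.length - 1` (the number of steps). -/
def IsDRATRefutation (F : CNF ν) (Fs : List (CNF ν)) : Prop :=
  Fs ≠ [] ∧ List.Chain' DRATStep Fs ∧ Fs.head? = some F ∧
    ∃ G, Fs.getLast? = some G ∧ (∅ : Clause ν) ∈ G

/-- The derivation `Fs` uses no variables other than those of `F` (DRAT⁻ condition). -/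
def NoNewVars (F : CNF ν) (Fs : List (CNF ν)) : Prop :=
  ∀ G ∈ Fs, cnfVars G ⊆ cnfVars F

set_option linter.unusedSectionVars false

/-! ### Unit propagation -/

theorem negLit_negLit (l : Lit ν) : negLit (negLit l) = l := by
  simp [negLit]

theorem negLit_ne (l : Lit ν) : negLit l ≠ l := by
  rcases l with ⟨v, b⟩
  cases b <;> simp [negLit]

/-- `P` is a consistent set of literals. -/
def Consist (P : Lit ν → Prop) : Prop := ∀ l, P l → ¬ P (negLit l)

/-- `P` is closed under unit propagation in `F`. -/
def UPClosed (P : Lit ν → Prop) (F : CNF ν) : Prop :=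
  ∀ C ∈ F, ∀ l ∈ C, (∀ m ∈ C, m ≠ l → P (negLit m)) → P l

theorem upRefutes_aux (F : CNF ν)
    (h : ∀ P : Lit ν → Prop, Consist P → UPClosed P F → False) :
    ∀ (k : ℕ) (L : Finset (Lit ν)) (G : CNF ν),
      ((F.sup id) \ L).card = k →
      (∀ l ∈ L, negLit l ∉ L) →
      (∀ C ∈ F, C.filter (fun m => negLit m ∉ L) ∈ G ∨
        ∃ l ∈ L, C.filter (fun m => negLit m ∉ L) = {l}) →
      UPRefutes G := by
  intro k
  induction k using Nat.strong_induction_on with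
  | _ k ih =>
    intro L G hk hcons hinv
    by_cases hcl : UPClosed (fun l => l ∈ L) F
    · exact (h _ hcons hcl).elim
    · unfold UPClosed at hcl
      push Not at hcl
      obtain ⟨C, hC, l, hl, hm, hlL⟩ := hcl
      by_cases hnl : negLit l ∈ L
      · have he : C.filter (fun m => negLit m ∉ L) = ∅ := by
          apply Finset.filter_eq_empty_iff.2
          intro m hmC
          rw [not_not]
          by_cases hml : m = l
          · rw [hml]; exact hnl
          · exact hm m hmC hml
        rcases hinv C hC with h1 | ⟨l', _, h1⟩
        · rw [he] at h1
          exact ⟨G, Relation.ReflTransGen.refl, h1⟩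
        · rw [he] at h1
          exact (Finset.singleton_ne_empty l' h1.symm).elim
      · have he : C.filter (fun m => negLit m ∉ L) = {l} := by
          ext m
          rw [Finset.mem_filter, Finset.mem_singleton]
          constructor
          · rintro ⟨h1, h2⟩
            by_contra hml
            exact h2 (hm m h1 hml)
          · rintro rfl
            exact ⟨hl, hnl⟩
        have hlG : ({l} : Clause ν) ∈ G := by
          rcases hinv C hC with h1 | ⟨l', h2, h1⟩
          · rwa [he] at h1
          · rw [he] at h1
            rw [Finset.singleton_inj.1 h1] at hlL
            exact (hlL h2).elim
        have hstep : UPStep G ((G.erase {l}) ∪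
            (G.filter (fun C => negLit l ∈ C)).image (fun C => C.erase (negLit l))) :=
          ⟨l, hlG, rfl⟩
        have hfil : ∀ D : Clause ν, D.filter (fun m => negLit m ∉ insert l L) =
            (D.filter (fun m => negLit m ∉ L)).erase (negLit l) := by
          intro D
          ext m
          have : negLit m = l ↔ m = negLit l := by
            constructor
            · rintro rfl; rw [negLit_negLit]
            · rintro rfl; rw [negLit_negLit]
          simp only [Finset.mem_filter, Finset.mem_insert, Finset.mem_erase, not_or, this]
          tauto
        have hrec := ih (((F.sup id) \ insert l L).card) (by
            rw [← hk]
            apply Finset.card_lt_card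
            refine Finset.ssubset_iff_subset_ne.2 ⟨?_, ?_⟩
            · exact Finset.sdiff_subset_sdiff le_rfl (Finset.subset_insert _ _)
            · intro heq
              have : l ∈ (F.sup id) \ L := by
                rw [Finset.mem_sdiff]
                exact ⟨Finset.mem_sup.2 ⟨C, hC, hl⟩, hlL⟩
              rw [← heq] at this
              simp at this) (insert l L)
            ((G.erase {l}) ∪
              (G.filter (fun C => negLit l ∈ C)).image (fun C => C.erase (negLit l))) rfl
            (by
              intro m hmL
              rw [Finset.mem_insert] at hmL ⊢
              rintro (h1 | h1)
              · rcases hmL with h2 | h2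
                · rw [h2] at h1; exact negLit_ne l h1
                · rw [← h1, negLit_negLit] at hnl; exact hnl h2
              · rcases hmL with h2 | h2
                · rw [h2] at h1; exact hnl h1
                · exact hcons m h2 h1)
            (by
              intro D hD
              rw [hfil]
              rcases hinv D hD with h1 | ⟨l', h2, h1⟩
              · by_cases h3 : negLit l ∈ D.filter (fun m => negLit m ∉ L)
                · left
                  apply Finset.mem_union_right
                  exact Finset.mem_image.2 ⟨_, Finset.mem_filter.2 ⟨h1, h3⟩, rfl⟩
                · rw [Finset.erase_eq_of_notMem h3]
                  by_cases h4 : D.filter (fun m => negLit m ∉ L) = {l}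
                  · right
                    exact ⟨l, Finset.mem_insert_self _ _, h4⟩
                  · left
                    apply Finset.mem_union_left
                    exact Finset.mem_erase.2 ⟨h4, h1⟩
              · right
                refine ⟨l', Finset.mem_insert_of_mem h2, ?_⟩
                rw [h1, Finset.erase_eq_of_notMem]
                rw [Finset.mem_singleton]
                rintro rfl
                exact hnl h2)
        obtain ⟨G', hG', he'⟩ := hrec
        exact ⟨G', Relation.ReflTransGen.head hstep hG', he'⟩

theorem upRefutes_of (F : CNF ν)
    (h : ∀ P : Lit ν → Prop, Consist P → UPClosed P F → False) : UPRefutes F := by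
  refine upRefutes_aux F h _ ∅ F rfl (by simp) ?_
  intro C hC
  left
  simpa using hC

theorem UPClosed.mono {P : Lit ν → Prop} {F G : CNF ν} (h : UPClosed P G) (hFG : F ⊆ G) :
    UPClosed P F := fun C hC => h C (hFG hC)

theorem UPClosed.neg {P : Lit ν → Prop} {F : CNF ν} {C : Clause ν} (h : UPClosed P F)
    (hC : clauseNegCNF C ⊆ F) {l : Lit ν} (hl : l ∈ C) : P (negLit l) := by
  apply h {negLit l} (hC (Finset.mem_image_of_mem _ hl)) (negLit l) (Finset.mem_singleton_self _)
  intro m hm hne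
  exact (hne (Finset.mem_singleton.1 hm)).elim

theorem isAT_of (F : CNF ν) (C : Clause ν)
    (h : ∀ P : Lit ν → Prop, Consist P → UPClosed P F → (∀ l ∈ C, P (negLit l)) → False) :
    IsAT F C := by
  apply upRefutes_of
  intro P h1 h2
  exact h P h1 (h2.mono Finset.subset_union_left)
    (fun l hl => h2.neg Finset.subset_union_right hl)

/-! ### Ternary xor constraints -/

/-- The literal of a clause excluding the value `b` of `l`. -/
def clit (l : Lit ν) (b : Bool) : Lit ν := if b then negLit l else l

@[simp] theorem clit_fst (l : Lit ν) (b : Bool) : (clit l b).1 = l.1 := by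
  cases b <;> rfl

theorem negLit_clit (l : Lit ν) (b : Bool) : negLit (clit l b) = clit l (!b) := by
  cases b <;> simp [clit, negLit_negLit]

theorem clit_inj (l : Lit ν) (b b' : Bool) (h : clit l b = clit l b') : b = b' := by
  cases b <;> cases b'
  · rfl
  · exact (negLit_ne l h.symm).elim
  · exact (negLit_ne l h).elim
  · rfl

/-- Ternary xor. -/
def xor3 (a b c : Lit ν) : CNF ν := xorCNF [a, b, c]

theorem mem_xor3 (a b c : Lit ν) (C : Clause ν) :
    C ∈ xor3 a b c ↔ ∃ α β γ : Bool, (α ^^ β ^^ γ) = true ∧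
      C = {clit a α, clit b β, clit c γ} := by
  have key : ∀ f : Fin 3 → Bool, (Finset.univ.filter (fun i => f i = true)).card % 2 = 1 ↔
      (f 0 ^^ f 1 ^^ f 2) = true := by decide
  have im : ∀ f : Fin 3 → Bool, (Finset.univ.image
      (fun i : Fin 3 => if f i then negLit ([a, b, c].get i) else [a, b, c].get i)) =
      {clit a (f 0), clit b (f 1), clit c (f 2)} := by
    intro f
    ext l
    simp only [Finset.mem_image, Finset.mem_univ, true_and, Finset.mem_insert,
      Finset.mem_singleton]
    constructor
    · rintro ⟨i, rfl⟩
      fin_cases i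
      · exact Or.inl rfl
      · exact Or.inr (Or.inl rfl)
      · exact Or.inr (Or.inr rfl)
    · rintro (h | h | h)
      · exact ⟨0, h.symm⟩
      · exact ⟨1, h.symm⟩
      · exact ⟨2, h.symm⟩
  unfold xor3 xorCNF parityCNF
  rw [Finset.mem_image]
  constructor
  · rintro ⟨f, hf, rfl⟩
    rw [Finset.mem_filter] at hf
    refine ⟨f 0, f 1, f 2, (key f).1 (by simpa using hf.2), im f⟩
  · rintro ⟨α, β, γ, h, rfl⟩
    refine ⟨![α, β, γ], ?_, im ![α, β, γ]⟩
    rw [Finset.mem_filter]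
    exact ⟨Finset.mem_univ _, by simpa using (key ![α, β, γ]).2 h⟩

theorem xor3_swap12 (a b c : Lit ν) : xor3 a b c = xor3 b a c := by
  ext C
  simp only [mem_xor3]
  constructor
  all_goals
    rintro ⟨α, β, γ, h, rfl⟩
    refine ⟨β, α, γ, ?_, Finset.insert_comm _ _ _⟩
    rw [← h, Bool.xor_comm β α]

theorem xor3_swap23 (a b c : Lit ν) : xor3 a b c = xor3 a c b := by
  ext C
  simp only [mem_xor3]
  constructor
  all_goals
    rintro ⟨α, β, γ, h, rfl⟩
    refine ⟨α, γ, β, ?_, by rw [Finset.pair_comm]⟩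
    rw [← h]
    cases α <;> cases β <;> cases γ <;> rfl

theorem xor3_card (a b c : Lit ν) : (xor3 a b c).card ≤ 4 := by
  have : xor3 a b c ⊆ (Finset.univ : Finset (Bool × Bool)).image
      (fun p => {clit a p.1, clit b p.2, clit c (!(p.1 ^^ p.2))}) := by
    intro C hC
    obtain ⟨α, β, γ, h, rfl⟩ := (mem_xor3 a b c C).1 hC
    refine Finset.mem_image.2 ⟨(α, β), Finset.mem_univ _, ?_⟩
    have : γ = !(α ^^ β) := by revert h; cases α <;> cases β <;> cases γ <;> decide
    rw [this]
  exact (Finset.card_le_card this).trans (Finset.card_image_le.trans (by decide))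

theorem cnfVars_union (F G : CNF ν) : cnfVars (F ∪ G) = cnfVars F ∪ cnfVars G := by
  ext v
  simp only [cnfVars, Set.mem_ofPred_eq, Set.mem_union, Finset.mem_union]
  constructor
  · rintro ⟨C, h | h, hb⟩
    · exact Or.inl ⟨C, h, hb⟩
    · exact Or.inr ⟨C, h, hb⟩
  · rintro (⟨C, h, hb⟩ | ⟨C, h, hb⟩)
    · exact ⟨C, Or.inl h, hb⟩
    · exact ⟨C, Or.inr h, hb⟩

theorem cnfVars_xor3 (a b c : Lit ν) (v : ν) (h : v ∈ cnfVars (xor3 a b c)) :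
    v = a.1 ∨ v = b.1 ∨ v = c.1 := by
  obtain ⟨C, hC, d, hd⟩ := h
  obtain ⟨α, β, γ, -, rfl⟩ := (mem_xor3 a b c C).1 hC
  simp only [Finset.mem_insert, Finset.mem_singleton] at hd
  rcases hd with h | h | h
  · left; have := congrArg Prod.fst h; simpa using this
  · right; left; have := congrArg Prod.fst h; simpa using this
  · right; right; have := congrArg Prod.fst h; simpa using this

/-- The literal `l` has value `b` under `P`. -/
def LVal (P : Lit ν → Prop) (l : Lit ν) (b : Bool) : Prop := P (negLit (clit l b))

theorem LVal.unique {P : Lit ν → Prop} (hP : Consist P) {l : Lit ν} {b b' : Bool}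
    (h : LVal P l b) (h' : LVal P l b') : b = b' := by
  by_contra hne
  have : b' = !b := by revert hne; cases b <;> cases b' <;> decide
  subst this
  unfold LVal at h h'
  rw [← negLit_clit] at h'
  exact hP _ h h'

theorem LVal.prop {P : Lit ν → Prop} {F : CNF ν} (hF : UPClosed P F) {a b c : Lit ν}
    (hs : xor3 a b c ⊆ F) {α β : Bool} (ha : LVal P a α) (hb : LVal P b β) :
    LVal P c (α ^^ β) := by
  unfold LVal
  rw [negLit_clit]
  apply hF {clit a α, clit b β, clit c (!(α ^^ β))}
  · apply hs
    rw [mem_xor3]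
    exact ⟨α, β, _, by cases α <;> cases β <;> rfl, rfl⟩
  · simp
  · intro m hm hne
    simp only [Finset.mem_insert, Finset.mem_singleton] at hm
    rcases hm with rfl | rfl | rfl
    · exact ha
    · exact hb
    · exact (hne rfl).elim

/-! ### Step counting -/

/-- `G` is reachable from `F` in at most `k` DRAT steps. -/
inductive Steps : ℕ → CNF ν → CNF ν → Prop
  | refl (k : ℕ) (F : CNF ν) : Steps k F F
  | cons {k : ℕ} {F G H : CNF ν} : DRATStep F G → Steps k G H → Steps (k + 1) F H

theorem DRATStep.symm {F G : CNF ν} (h : DRATStep F G) : DRATStep G F := by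
  rcases h with ⟨C, hC, rfl⟩ | ⟨C, hCF, hC, rfl⟩
  · by_cases hm : C ∈ F
    · rw [Finset.insert_eq_of_mem hm]
      left
      exact ⟨C, hC, (Finset.insert_eq_of_mem hm).symm⟩
    · right
      refine ⟨C, Finset.mem_insert_self _ _, ?_, ?_⟩
      · rwa [Finset.erase_insert hm]
      · rw [Finset.erase_insert hm]
  · left
    exact ⟨C, hC, (Finset.insert_erase hCF).symm⟩

theorem Steps.mono {k k' : ℕ} {F G : CNF ν} (h : Steps k F G) (hk : k ≤ k') : Steps k' F G := by
  induction h generalizing k' with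
  | refl k F => exact Steps.refl _ _
  | cons h1 _ ih =>
    obtain ⟨j, rfl⟩ : ∃ j, k' = j + 1 := ⟨k' - 1, by omega⟩
    exact Steps.cons h1 (ih (by omega))

theorem Steps.trans {k k' : ℕ} {F G H : CNF ν} (h : Steps k F G) (h' : Steps k' G H) :
    Steps (k + k') F H := by
  induction h with
  | refl k F => exact h'.mono (by omega)
  | cons h1 _ ih => exact (Steps.cons h1 (ih h')).mono (by omega)

theorem Steps.symm {k : ℕ} {F G : CNF ν} (h : Steps k F G) : Steps k G F := by
  induction h with
  | refl k F => exact Steps.refl _ _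
  | cons h1 _ ih => exact ih.trans (Steps.cons h1.symm (Steps.refl 0 _))

theorem Steps.toList {k : ℕ} {F G : CNF ν} (h : Steps k F G) :
    ∃ Fs : List (CNF ν), List.IsChain DRATStep Fs ∧ Fs.head? = some F ∧
      Fs.getLast? = some G ∧ Fs.length ≤ k + 1 := by
  induction h with
  | refl k F => exact ⟨[F], by simp, by simp, by simp, by simp⟩
  | @cons k F G H h1 _ ih =>
    obtain ⟨Fs, h2, h3, h4, h5⟩ := ih
    refine ⟨F :: Fs, ?_, by simp, ?_, by simpa using h5⟩
    · rw [List.isChain_cons]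
      refine ⟨?_, h2⟩
      intro y hy
      rw [h3] at hy
      rw [Option.mem_some_iff] at hy
      rw [← hy]; exact h1
    · cases Fs with
      | nil => simp at h3
      | cons a l => rw [List.getLast?_cons_cons]; exact h4

theorem steps_of_intermediate (H' : CNF ν) : ∀ (k : ℕ) (H : CNF ν), H ⊆ H' →
    (H' \ H).card ≤ k →
    (∀ K, H ⊆ K → K ⊆ H' → ∀ C ∈ H', C ∉ K → IsAT K C ∨ IsRAT K C) → Steps k H H' := by
  intro k
  induction k with
  | zero =>
    intro H hs hc _
    have : H = H' := by
      apply Finset.Subset.antisymm hs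
      rw [← Finset.sdiff_eq_empty_iff_subset]
      exact Finset.card_eq_zero.1 (by omega)
    rw [this]
    exact Steps.refl _ _
  | succ k ih =>
    intro H hs hc h
    by_cases he : H' ⊆ H
    · rw [Finset.Subset.antisymm hs he]
      exact Steps.refl _ _
    · obtain ⟨C, hC, hCH⟩ := Finset.not_subset.1 he
      have hins : insert C H ⊆ H' := Finset.insert_subset hC hs
      refine Steps.cons (G := insert C H) (Or.inl ⟨C, h H le_rfl hs C hC hCH, rfl⟩) ?_
      apply ih _ hins
      · have : (H' \ insert C H).card < (H' \ H).card := by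
          apply Finset.card_lt_card
          refine Finset.ssubset_iff_subset_ne.2 ⟨?_, ?_⟩
          · exact Finset.sdiff_subset_sdiff le_rfl (Finset.subset_insert _ _)
          · intro heq
            have : C ∈ H' \ H := Finset.mem_sdiff.2 ⟨hC, hCH⟩
            rw [← heq] at this
            simp at this
        omega
      · intro K hK hK' D hD hDK
        exact h K ((Finset.subset_insert _ _).trans hK) hK' D hD hDK

/-- Adding (or, read backwards, deleting) a set of asymmetric tautologies. -/
theorem steps_AT (H Q : CNF ν) (k : ℕ) (hk : Q.card ≤ k)
    (h : ∀ C ∈ Q, ∀ P : Lit ν → Prop, Consist P → UPClosed P H →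
      (∀ l ∈ C, P (negLit l)) → False) : Steps k H (H ∪ Q) := by
  apply steps_of_intermediate _ _ _ Finset.subset_union_left
  · refine (Finset.card_le_card ?_).trans hk
    intro C hC
    simp only [Finset.mem_sdiff, Finset.mem_union] at hC
    tauto
  · intro K hK _ C hC hCK
    left
    apply isAT_of
    intro P h1 h2 h3
    rcases Finset.mem_union.1 hC with h4 | h4
    · exact hCK (hK h4)
    · exact h C h4 P h1 (h2.mono hK) h3

/-- Introducing a definition `w = a ⊕ c`. -/
theorem steps_def (G : CNF ν) (a c w : Lit ν) (hG : w.1 ∉ cnfVars G) (ha : w.1 ≠ a.1)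
    (hc : w.1 ≠ c.1) : Steps 4 G (G ∪ xor3 a c w) := by
  apply steps_of_intermediate _ _ _ Finset.subset_union_left
  · refine (Finset.card_le_card ?_).trans (xor3_card a c w)
    intro C hC
    simp only [Finset.mem_sdiff, Finset.mem_union] at hC
    tauto
  · intro K hK hK' C hC hCK
    right
    have hC' : C ∈ xor3 a c w := by
      rcases Finset.mem_union.1 hC with h | h
      · exact (hCK (hK h)).elim
      · exact h
    obtain ⟨α, β, γ, hx, rfl⟩ := (mem_xor3 a c w C).1 hC'
    refine ⟨clit w γ, by simp, ?_⟩
    intro D hD hwD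
    have hD' : D ∈ xor3 a c w := by
      rcases Finset.mem_union.1 (hK' hD) with h | h
      · refine (hG ⟨D, h, !(clit w γ).2, ?_⟩).elim
        have : negLit (clit w γ) = (w.1, !(clit w γ).2) := by
          simp [negLit]
        rw [← this]; exact hwD
      · exact h
    obtain ⟨α', β', γ', hx', rfl⟩ := (mem_xor3 a c w D).1 hD'
    have hγ : γ' = !γ := by
      rw [negLit_clit] at hwD
      simp only [Finset.mem_insert, Finset.mem_singleton] at hwD
      rcases hwD with h | h | h
      · exact (ha (by simpa using congrArg Prod.fst h)).elim
      · exact (hc (by simpa using congrArg Prod.fst h)).elim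
      · exact (clit_inj _ _ _ h).symm
    apply upRefutes_of
    intro P hP hcl
    have h1 : ∀ l ∈ ({clit a α, clit c β, clit w γ} : Clause ν), P (negLit l) :=
      fun l hl => hcl.neg Finset.subset_union_right hl
    have h2 : ∀ l ∈ ({clit a α', clit c β', clit w γ'} : Clause ν).erase (negLit (clit w γ)),
        P (negLit l) :=
      fun l hl => hcl.neg
        (Finset.subset_union_right.trans Finset.subset_union_left) hl
    have e1 : α = α' := by
      refine LVal.unique hP (l := a) (h1 _ (by simp)) (h2 _ ?_)
      rw [Finset.mem_erase]
      refine ⟨fun h => ha ?_, by simp⟩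
      rw [negLit_clit] at h
      simpa using (congrArg Prod.fst h).symm
    have e2 : β = β' := by
      refine LVal.unique hP (l := c) (h1 _ (by simp)) (h2 _ ?_)
      rw [Finset.mem_erase]
      refine ⟨fun h => hc ?_, by simp⟩
      rw [negLit_clit] at h
      simpa using (congrArg Prod.fst h).symm
    subst e1 e2 hγ
    revert hx hx'
    cases α <;> cases β <;> cases γ <;> decide

/-! ### The local move -/

/-- Auxiliary width-four clauses. -/
def quadQ (a w b v : Lit ν) : CNF ν := (Finset.univ : Finset (Bool × Bool × Bool)).image
    (fun p => {clit a p.1, clit w p.2.1, clit b p.2.2, clit v (!(p.2.1 ^^ p.2.2))})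

theorem quadQ_card (a w b v : Lit ν) : (quadQ a w b v).card ≤ 8 := by
  unfold quadQ
  exact Finset.card_image_le

theorem mem_quadQ (a w b v : Lit ν) (C : Clause ν) : C ∈ quadQ a w b v ↔
    ∃ α β γ : Bool, C = {clit a α, clit w β, clit b γ, clit v (!(β ^^ γ))} := by
  unfold quadQ
  rw [Finset.mem_image]
  constructor
  · rintro ⟨⟨α, β, γ⟩, -, rfl⟩
    exact ⟨α, β, γ, rfl⟩
  · rintro ⟨α, β, γ, rfl⟩
    exact ⟨(α, β, γ), Finset.mem_univ _, rfl⟩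

theorem half_move (G : CNF ν) (a b c u v w : Lit ν)
    (hG : w.1 ∉ cnfVars G) (ha : w.1 ≠ a.1) (hb : w.1 ≠ b.1) (hc : w.1 ≠ c.1) (hu : w.1 ≠ u.1)
    (hv : w.1 ≠ v.1) :
    Steps 24 (G ∪ (xor3 a b u ∪ xor3 u c v))
      (G ∪ (xor3 a b u ∪ xor3 u c v ∪ (xor3 a c w ∪ xor3 w b v))) := by
  obtain ⟨H0, hH0⟩ : ∃ H0, H0 = G ∪ (xor3 a b u ∪ xor3 u c v) := ⟨_, rfl⟩
  rw [← hH0]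
  have hw0 : w.1 ∉ cnfVars H0 := by
    rw [hH0, cnfVars_union, cnfVars_union]
    rintro (h | h | h)
    · exact hG h
    · rcases cnfVars_xor3 _ _ _ _ h with h | h | h <;> contradiction
    · rcases cnfVars_xor3 _ _ _ _ h with h | h | h <;> contradiction
  have s1 := steps_def H0 a c w hw0 ha hc
  obtain ⟨H1, hH1⟩ : ∃ H1, H1 = H0 ∪ xor3 a c w := ⟨_, rfl⟩
  rw [← hH1] at s1
  obtain ⟨Q, hQdef⟩ : ∃ Q, Q = quadQ a w b v := ⟨_, rfl⟩
  have hQ : Q.card ≤ 8 := by rw [hQdef]; exact quadQ_card _ _ _ _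
  have sub1 : xor3 a b u ⊆ H1 := by
    intro C hC; simp only [hH1, hH0, Finset.mem_union]; tauto
  have sub2 : xor3 u c v ⊆ H1 := by
    intro C hC; simp only [hH1, hH0, Finset.mem_union]; tauto
  have sub3 : xor3 a c w ⊆ H1 := by
    intro C hC; simp only [hH1, hH0, Finset.mem_union]; tauto
  have hQAT : ∀ C ∈ Q, ∀ P : Lit ν → Prop, Consist P → UPClosed P H1 →
      (∀ l ∈ C, P (negLit l)) → False := by
    intro C hC P hP hcl hn
    rw [hQdef, mem_quadQ] at hC
    obtain ⟨α, β, γ, rfl⟩ := hC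
    have va : LVal P a α := hn _ (by simp)
    have vw : LVal P w β := hn _ (by simp)
    have vb : LVal P b γ := hn _ (by simp)
    have vv : LVal P v (!(β ^^ γ)) := hn _ (by simp)
    have vu := LVal.prop hcl sub1 va vb
    have vc := LVal.prop hcl (a := u) (b := v) (c := c)
      (by rw [xor3_swap23]; exact sub2) vu vv
    have vw' := LVal.prop hcl sub3 va vc
    have := LVal.unique hP vw vw'
    revert this
    cases α <;> cases β <;> cases γ <;> decide
  have s2 := steps_AT H1 Q 8 hQ hQAT
  have s3 := steps_AT (H1 ∪ Q) (xor3 w b v) 4 (xor3_card _ _ _) (by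
    intro C hC P hP hcl hn
    obtain ⟨β, γ, δ, hx, rfl⟩ := (mem_xor3 _ _ _ _).1 hC
    have vw : LVal P w β := hn _ (by simp)
    have vb : LVal P b γ := hn _ (by simp)
    have vv : LVal P v δ := hn _ (by simp)
    have hδ : δ = !(β ^^ γ) := by revert hx; cases β <;> cases γ <;> cases δ <;> decide
    have key : ∀ α, P (clit a α) := by
      intro α
      apply hcl {clit a α, clit w β, clit b γ, clit v (!(β ^^ γ))}
      · apply Finset.mem_union_right
        rw [hQdef, mem_quadQ]
        exact ⟨α, β, γ, rfl⟩
      · simp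
      · intro m hm hne
        simp only [Finset.mem_insert, Finset.mem_singleton] at hm
        rcases hm with rfl | rfl | rfl | rfl
        · exact (hne rfl).elim
        · exact vw
        · exact vb
        · rw [← hδ]; exact vv
    have h1 := key false
    have h2 := key true
    apply hP _ h1
    rw [negLit_clit]
    exact h2)
  have s4 := steps_AT (H1 ∪ xor3 w b v) Q 8 hQ (fun C hC P hP hcl hn =>
    hQAT C hC P hP (hcl.mono Finset.subset_union_left) hn)
  have e : H1 ∪ xor3 w b v ∪ Q = H1 ∪ Q ∪ xor3 w b v := Finset.union_right_comm _ _ _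
  rw [e] at s4
  have := ((s1.trans s2).trans s3).trans s4.symm
  have e2 : H1 ∪ xor3 w b v =
      G ∪ (xor3 a b u ∪ xor3 u c v ∪ (xor3 a c w ∪ xor3 w b v)) := by
    simp only [hH1, hH0, Finset.union_assoc]
  rw [← e2]
  exact this

theorem full_move (G : CNF ν) (a b c u v w : Lit ν)
    (hG : w.1 ∉ cnfVars G) (ha : w.1 ≠ a.1) (hb : w.1 ≠ b.1) (hc : w.1 ≠ c.1) (hu : w.1 ≠ u.1)
    (hv : w.1 ≠ v.1)
    (hG' : u.1 ∉ cnfVars G) (ha' : u.1 ≠ a.1) (hb' : u.1 ≠ b.1) (hc' : u.1 ≠ c.1)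
    (hv' : u.1 ≠ v.1) :
    Steps 48 (G ∪ (xor3 a b u ∪ xor3 u c v)) (G ∪ (xor3 a c w ∪ xor3 w b v)) := by
  have h1 := half_move G a b c u v w hG ha hb hc hu hv
  have h2 := half_move G a c b w v u hG' ha' hc' hb' (Ne.symm hu) hv'
  rw [Finset.union_comm (xor3 a c w ∪ xor3 w b v)] at h2
  exact h1.trans h2.symm

/-! ### Combs -/

section Combs

variable {ι : Type} [DecidableEq ι]

/-- The constraint `V A ⊕ V B = V (A ∪ B)`. -/
def ctr (V : Finset ι → Lit ν) (A B : Finset ι) : CNF ν := xor3 (V A) (V B) (V (A ∪ B))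

/-- The comb over a list of leaves. -/
def comb (V : Finset ι → Lit ν) : List ι → CNF ν
  | [] => ∅
  | x :: L => if L = [] then ∅ else ctr V L.toFinset {x} ∪ comb V L

theorem comb_singleton (V : Finset ι → Lit ν) (x : ι) : comb V [x] = ∅ := by
  simp [comb]

theorem comb_cons (V : Finset ι → Lit ν) (x : ι) (L : List ι) (h : L ≠ []) :
    comb V (x :: L) = ctr V L.toFinset {x} ∪ comb V L := by
  simp [comb, h]

theorem ctr_comm (V : Finset ι → Lit ν) (A B : Finset ι) : ctr V A B = ctr V B A := by
  unfold ctr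
  rw [xor3_swap12, Finset.union_comm]

/-- The names of sets of size between `2` and `m - 1` are unique. -/
def Good (V : Finset ι → Lit ν) (m : ℕ) : Prop :=
  ∀ R R' : Finset ι, 2 ≤ R.card → R.card < m → R'.Nonempty → R'.card ≤ m →
    (V R').1 = (V R).1 → R' = R

/-- The names of the proper subsets of `S` do not occur in `G`. -/
def Fr (V : Finset ι → Lit ν) (S : Finset ι) (G : CNF ν) : Prop :=
  ∀ R, R ⊂ S → 2 ≤ R.card → (V R).1 ∉ cnfVars G

/-- Equivalence in at most `k` steps, in every admissible context. -/
def Eqv (V : Finset ι → Lit ν) (k : ℕ) (S : Finset ι) (H H' : CNF ν) : Prop :=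
  ∀ G, Fr V S G → Steps k (G ∪ H) (G ∪ H')

theorem vars_comb (V : Finset ι → Lit ν) (L : List ι) (v : ν) (hv : v ∈ cnfVars (comb V L)) :
    ∃ R, R ⊆ L.toFinset ∧ R.Nonempty ∧ v = (V R).1 := by
  induction L with
  | nil =>
    obtain ⟨C, hC, _⟩ := hv
    simp [comb] at hC
  | cons x L ih =>
    by_cases hL : L = []
    · subst hL
      obtain ⟨C, hC, _⟩ := hv
      simp [comb] at hC
    · rw [comb_cons V x L hL, cnfVars_union] at hv
      rw [List.toFinset_cons]
      rcases hv with h | h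
      · rcases cnfVars_xor3 _ _ _ _ h with h | h | h
        · exact ⟨L.toFinset, Finset.subset_insert _ _, by simpa using hL, h⟩
        · exact ⟨{x}, by simp, by simp, h⟩
        · exact ⟨L.toFinset ∪ {x}, by rw [Finset.insert_eq, Finset.union_comm], by simp, h⟩
      · obtain ⟨R, h1, h2, h3⟩ := ih h
        exact ⟨R, h1.trans (Finset.subset_insert _ _), h2, h3⟩

theorem Fr.mono {V : Finset ι → Lit ν} {S S' : Finset ι} {G : CNF ν} (h : Fr V S G)
    (hs : S' ⊆ S) : Fr V S' G :=
  fun R hR h2 => h R (lt_of_lt_of_le hR hs) h2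

theorem Fr.union {V : Finset ι → Lit ν} {S : Finset ι} {G H : CNF ν} (h : Fr V S G)
    (h' : Fr V S H) : Fr V S (G ∪ H) := by
  intro R hR h2
  rw [cnfVars_union]
  rintro (h3 | h3)
  · exact h R hR h2 h3
  · exact h' R hR h2 h3

theorem Fr.ctr {V : Finset ι → Lit ν} {m : ℕ} (hV : Good V m) {A B : Finset ι}
    (hA : A.Nonempty) (hB : B.Nonempty) (hd : Disjoint A B) (hm : (A ∪ B).card ≤ m) :
    Fr V A (ctr V A B) := by
  intro R hR h2 hv
  have hRA : R.card < A.card := Finset.card_lt_card hR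
  have hAm : A.card ≤ (A ∪ B).card := Finset.card_le_card Finset.subset_union_left
  have hBm : B.card ≤ (A ∪ B).card := Finset.card_le_card Finset.subset_union_right
  have hRne : R.Nonempty := Finset.card_pos.1 (by omega)
  rcases cnfVars_xor3 _ _ _ _ hv with h | h | h
  · have := hV R A h2 (by omega) hA (by omega) h.symm
    rw [this] at hRA; omega
  · have := hV R B h2 (by omega) hB (by omega) h.symm
    subst this
    obtain ⟨r, hr⟩ := hRne
    exact Finset.disjoint_left.1 hd (hR.1 hr) hr
  · have := hV R (A ∪ B) h2 (by omega) (hA.mono Finset.subset_union_left) hm h.symm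
    rw [this] at hAm; omega

theorem Fr.comb {V : Finset ι → Lit ν} {m : ℕ} (hV : Good V m) {A : Finset ι} {L : List ι}
    (hd : Disjoint A L.toFinset) (hA : A.card ≤ m) (hL : L.toFinset.card ≤ m) :
    Fr V A (comb V L) := by
  intro R hR h2 hv
  have hRA : R.card < A.card := Finset.card_lt_card hR
  obtain ⟨R', h3, h4, h5⟩ := vars_comb V L _ hv
  have h6 := Finset.card_le_card h3
  have := hV R R' h2 (by omega) h4 (by omega) h5.symm
  subst this
  obtain ⟨r, hr⟩ := h4
  exact Finset.disjoint_left.1 hd (hR.1 hr) (h3 hr)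

/-- `Interl L A B`: the list `L` is an interleaving of `A` and `B`. -/
inductive Interl : List ι → List ι → List ι → Prop
  | nil : Interl [] [] []
  | left (x : ι) {L A B : List ι} : Interl L A B → Interl (x :: L) (x :: A) B
  | right (x : ι) {L A B : List ι} : Interl L A B → Interl (x :: L) A (x :: B)

theorem Interl.symm {L A B : List ι} (h : Interl L A B) : Interl L B A := by
  induction h with
  | nil => exact Interl.nil
  | left x _ ih => exact Interl.right x ih
  | right x _ ih => exact Interl.left x ih

theorem Interl.perm {L A B : List ι} (h : Interl L A B) : L.Perm (A ++ B) := by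
  induction h with
  | nil => exact List.Perm.refl _
  | left x _ ih => exact ih.cons x
  | right x _ ih => exact (ih.cons x).trans List.perm_middle.symm

theorem Interl.eq_of_nil {L A B : List ι} (h : Interl L A B) (hA : A = []) : L = B := by
  induction h with
  | nil => rfl
  | left x _ ih => simp at hA
  | right x _ ih => rw [ih hA]

theorem interl_append (A B : List ι) : Interl (A ++ B) A B := by
  induction A with
  | nil =>
    induction B with
    | nil => exact Interl.nil
    | cons x B ih => exact Interl.right x ih
  | cons x A ih => exact Interl.left x ih

theorem exists_interl (L : List ι) : ∀ A B : List ι, L.Perm (A ++ B) →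
    ∃ A' B', Interl L A' B' ∧ A'.Perm A ∧ B'.Perm B := by
  induction L with
  | nil =>
    intro A B h
    have h0 := h.nil_eq
    have h1 := List.append_eq_nil_iff.1 h0.symm
    exact ⟨[], [], Interl.nil, by rw [h1.1], by rw [h1.2]⟩
  | cons x L ih =>
    intro A B h
    have hx : x ∈ A ++ B := h.subset (by simp)
    rcases List.mem_append.1 hx with hx | hx
    · have hA := List.perm_cons_erase hx
      have : (x :: L).Perm (x :: (A.erase x ++ B)) := h.trans (hA.append_right B)
      obtain ⟨A', B', h1, h2, h3⟩ := ih _ _ this.cons_inv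
      exact ⟨x :: A', B', Interl.left x h1, (h2.cons x).trans hA.symm, h3⟩
    · have hB := List.perm_cons_erase hx
      have : (x :: L).Perm (x :: (A ++ B.erase x)) :=
        (h.trans (hB.append_left A)).trans List.perm_middle
      obtain ⟨A', B', h1, h2, h3⟩ := ih _ _ this.cons_inv
      exact ⟨A', x :: B', Interl.right x h1, h2, (h3.cons x).trans hB.symm⟩

theorem interl_step (V : Finset ι → Lit ν) (m k : ℕ) (hV : Good V m) (x : ι) (L A B : List ι)
    (hI : Interl L A B) (hnd : (x :: L).Nodup) (hm : (x :: L).length ≤ m) (hB : B ≠ [])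
    (ih : A ≠ [] → Eqv V k L.toFinset
      (ctr V A.toFinset B.toFinset ∪ (comb V A ∪ comb V B)) (comb V L)) :
    Eqv V (k + 48) (x :: L).toFinset
      (ctr V (x :: A).toFinset B.toFinset ∪ (comb V (x :: A) ∪ comb V B)) (comb V (x :: L)) := by
  intro G hG
  by_cases hA : A = []
  · have hLB := hI.eq_of_nil hA
    subst hLB hA
    rw [comb_singleton, comb_cons V x L hB, Finset.empty_union, ctr_comm]
    simp only [List.toFinset_cons, List.toFinset_nil, insert_empty_eq]
    exact Steps.refl _ _
  · have hp := hI.perm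
    have hLne : L ≠ [] := by
      rintro rfl
      have := List.append_eq_nil_iff.1 hp.nil_eq.symm
      exact hA this.1
    have hLset : L.toFinset = A.toFinset ∪ B.toFinset := by
      rw [List.toFinset_eq_of_perm _ _ hp, List.toFinset_append]
    rw [List.nodup_cons] at hnd
    have hnd' : (A ++ B).Nodup := hp.nodup_iff.1 hnd.2
    have hdAB : Disjoint A.toFinset B.toFinset := by
      rw [List.disjoint_toFinset_iff_disjoint]
      exact List.disjoint_of_nodup_append hnd'
    have hLcard : L.toFinset.card = L.length := List.toFinset_card_of_nodup hnd.2
    have hxL : x ∉ L.toFinset := by simpa using hnd.1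
    have hxA : x ∉ A.toFinset := by
      rw [hLset, Finset.mem_union] at hxL; tauto
    have hxB : x ∉ B.toFinset := by
      rw [hLset, Finset.mem_union] at hxL; tauto
    have hAne : A.toFinset.Nonempty := by simpa using hA
    have hBne : B.toFinset.Nonempty := by simpa using hB
    have cAB : (A.toFinset ∪ B.toFinset).card = A.toFinset.card + B.toFinset.card :=
      Finset.card_union_of_disjoint hdAB
    have cAx : (A.toFinset ∪ {x}).card = A.toFinset.card + 1 := by
      rw [Finset.card_union_of_disjoint (by simpa using hxA), Finset.card_singleton]
    have cS : (A.toFinset ∪ B.toFinset ∪ {x}).card = A.toFinset.card + B.toFinset.card + 1 := by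
      rw [Finset.card_union_of_disjoint (by rw [← hLset]; simpa using hxL),
        Finset.card_singleton, cAB]
    have hApos := Finset.card_pos.2 hAne
    have hBpos := Finset.card_pos.2 hBne
    have hm' : A.toFinset.card + B.toFinset.card + 1 ≤ m := by
      rw [← cAB, ← hLset, hLcard]; simpa using hm
    have eS : A.toFinset ∪ {x} ∪ B.toFinset = A.toFinset ∪ B.toFinset ∪ {x} :=
      Finset.union_right_comm _ _ _
    have exA : (x :: A).toFinset = A.toFinset ∪ {x} := by
      rw [List.toFinset_cons, Finset.insert_eq, Finset.union_comm]
    have exL : (x :: L).toFinset = A.toFinset ∪ B.toFinset ∪ {x} := by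
      rw [List.toFinset_cons, Finset.insert_eq, Finset.union_comm, hLset]
    -- uniqueness of the two names
    have uw : ∀ R : Finset ι, R.Nonempty → R.card ≤ m → R ≠ A.toFinset ∪ B.toFinset →
        (V (A.toFinset ∪ B.toFinset)).1 ≠ (V R).1 := by
      intro R h1 h2 h3 h4
      exact h3 (hV _ R (by omega) (by omega) h1 h2 h4.symm)
    have uu : ∀ R : Finset ι, R.Nonempty → R.card ≤ m → R ≠ A.toFinset ∪ {x} →
        (V (A.toFinset ∪ {x})).1 ≠ (V R).1 := by
      intro R h1 h2 h3 h4
      exact h3 (hV _ R (by omega) (by omega) h1 h2 h4.symm)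
    have ne_of_card : ∀ R R' : Finset ι, R.card ≠ R'.card → R ≠ R' := by
      rintro R R' h rfl; exact h rfl
    have hxw : ({x} : Finset ι) ≠ A.toFinset ∪ B.toFinset := by
      apply ne_of_card; rw [Finset.card_singleton]; omega
    have hBu : B.toFinset ≠ A.toFinset ∪ {x} := by
      intro h; apply hxB; rw [h]; simp
    have huw : A.toFinset ∪ {x} ≠ A.toFinset ∪ B.toFinset := by
      intro h; apply hxL; rw [hLset, ← h]; simp
    have hfrW : (V (A.toFinset ∪ B.toFinset)).1 ∉ cnfVars (G ∪ (comb V A ∪ comb V B)) := by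
      rw [cnfVars_union, cnfVars_union]
      rintro (h | h | h)
      · refine hG _ ?_ (by omega) h
        rw [exL]
        refine Finset.ssubset_iff_subset_ne.2 ⟨Finset.subset_union_left, ne_of_card _ _ (by omega)⟩
      · obtain ⟨R, h1, h2, h3⟩ := vars_comb V A _ h
        have := Finset.card_le_card h1
        exact uw R h2 (by omega) (ne_of_card _ _ (by omega)) h3
      · obtain ⟨R, h1, h2, h3⟩ := vars_comb V B _ h
        have := Finset.card_le_card h1
        exact uw R h2 (by omega) (ne_of_card _ _ (by omega)) h3
    have hfrU : (V (A.toFinset ∪ {x})).1 ∉ cnfVars (G ∪ (comb V A ∪ comb V B)) := by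
      rw [cnfVars_union, cnfVars_union]
      rintro (h | h | h)
      · refine hG _ ?_ (by omega) h
        rw [exL]
        refine Finset.ssubset_iff_subset_ne.2 ⟨?_, ne_of_card _ _ (by omega)⟩
        rw [← eS]; exact Finset.subset_union_left
      · obtain ⟨R, h1, h2, h3⟩ := vars_comb V A _ h
        have := Finset.card_le_card h1
        exact uu R h2 (by omega) (ne_of_card _ _ (by omega)) h3
      · obtain ⟨R, h1, h2, h3⟩ := vars_comb V B _ h
        have := Finset.card_le_card h1
        refine uu R h2 (by omega) ?_ h3
        rintro rfl
        exact hxB (h1 (by simp))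
    have mv := full_move (G ∪ (comb V A ∪ comb V B)) (V A.toFinset) (V {x}) (V B.toFinset)
      (V (A.toFinset ∪ {x})) (V (A.toFinset ∪ B.toFinset ∪ {x})) (V (A.toFinset ∪ B.toFinset))
      hfrW
      (uw _ hAne (by omega) (ne_of_card _ _ (by omega)))
      (uw _ (by simp) (by rw [Finset.card_singleton]; omega) hxw)
      (uw _ hBne (by omega) (ne_of_card _ _ (by omega)))
      (uw _ (by simp) (by omega) huw)
      (uw _ (by simp) (by omega) (ne_of_card _ _ (by omega)))
      hfrU
      (uu _ hAne (by omega) (ne_of_card _ _ (by omega)))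
      (uu _ (by simp) (by rw [Finset.card_singleton]; omega)
        (ne_of_card _ _ (by rw [Finset.card_singleton]; omega)))
      (uu _ hBne (by omega) hBu)
      (uu _ (by simp) (by omega) (ne_of_card _ _ (by omega)))
    have hrec := ih hA (G ∪ ctr V L.toFinset {x}) (by
      apply Fr.union
      · apply hG.mono
        rw [List.toFinset_cons]; exact Finset.subset_insert _ _
      · apply Fr.ctr hV
        · rw [hLset]; exact hAne.mono Finset.subset_union_left
        · simp
        · simpa using hxL
        · rw [hLset]; omega)
    have e1 : G ∪ (ctr V (x :: A).toFinset B.toFinset ∪ (comb V (x :: A) ∪ comb V B)) =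
        G ∪ (comb V A ∪ comb V B) ∪ (xor3 (V A.toFinset) (V {x}) (V (A.toFinset ∪ {x})) ∪
          xor3 (V (A.toFinset ∪ {x})) (V B.toFinset)
            (V (A.toFinset ∪ B.toFinset ∪ {x}))) := by
      rw [exA, comb_cons V x A hA]
      unfold ctr
      rw [eS]
      ac_rfl
    have e2 : G ∪ (comb V A ∪ comb V B) ∪
        (xor3 (V A.toFinset) (V B.toFinset) (V (A.toFinset ∪ B.toFinset)) ∪
          xor3 (V (A.toFinset ∪ B.toFinset)) (V {x}) (V (A.toFinset ∪ B.toFinset ∪ {x}))) =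
        G ∪ ctr V L.toFinset {x} ∪
          (ctr V A.toFinset B.toFinset ∪ (comb V A ∪ comb V B)) := by
      rw [hLset]
      unfold ctr
      ac_rfl
    have e3 : G ∪ comb V (x :: L) = G ∪ ctr V L.toFinset {x} ∪ comb V L := by
      rw [comb_cons V x L hLne, Finset.union_assoc]
    rw [e1, e3]
    rw [e2] at mv
    exact (mv.trans hrec).mono (by omega)

theorem interl_eqv (V : Finset ι → Lit ν) (m : ℕ) (hV : Good V m) {L A B : List ι}
    (hI : Interl L A B) (hnd : L.Nodup) (hm : L.length ≤ m) (hA : A ≠ []) (hB : B ≠ []) :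
    Eqv V (48 * L.length) L.toFinset
      (ctr V A.toFinset B.toFinset ∪ (comb V A ∪ comb V B)) (comb V L) := by
  induction hI with
  | nil => exact (hA rfl).elim
  | @left x L A B hI ih =>
    have := interl_step V m (48 * L.length) hV x L A B hI hnd hm hB
      (fun hA' => ih (List.nodup_cons.1 hnd).2 (by simp at hm; omega) hA' hB)
    simpa [Nat.mul_add] using this
  | @right x L A B hI ih =>
    have := interl_step V m (48 * L.length) hV x L B A hI.symm hnd hm hA
      (fun hB' => by
        rw [ctr_comm, Finset.union_comm (comb V B)]
        exact ih (List.nodup_cons.1 hnd).2 (by simp at hm; omega) hA hB')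
    rw [ctr_comm, Finset.union_comm (comb V (x :: B))] at this
    simpa [Nat.mul_add] using this

theorem sort_eqv (V : Finset ι → Lit ν) (m : ℕ) (hV : Good V m) (k : ℕ) :
    ∀ L L' : List ι, L.Nodup → L.Perm L' → L.length ≤ 2 ^ k → L.length ≤ m →
      Eqv V (96 * k * L.length) L.toFinset (comb V L) (comb V L') := by
  induction k with
  | zero =>
    intro L L' hnd hp hk hm G hG
    have : L = L' := by
      match L, hk with
      | [], _ => exact hp.nil_eq
      | [a], _ => exact List.singleton_perm.1 hp
    rw [this]
    exact Steps.refl _ _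
  | succ k ih =>
    intro L L' hnd hp hk hm G hG
    by_cases h1 : L.length ≤ 1
    · have : L = L' := by
        match L, h1 with
        | [], _ => exact hp.nil_eq
        | [a], _ => exact List.singleton_perm.1 hp
      rw [this]
      exact Steps.refl _ _
    · obtain ⟨A, B, rfl, hAl, hBl, hA, hB⟩ : ∃ A B : List ι, L' = A ++ B ∧ A.length ≤ 2 ^ k ∧
          B.length ≤ 2 ^ k ∧ A ≠ [] ∧ B ≠ [] := by
        have hl := hp.length_eq
        rw [pow_succ] at hk
        refine ⟨L'.take (L.length / 2), L'.drop (L.length / 2),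
          (List.take_append_drop _ _).symm, ?_, ?_, ?_, ?_⟩
        · rw [List.length_take]; omega
        · rw [List.length_drop]; omega
        · apply List.ne_nil_of_length_pos; rw [List.length_take]; omega
        · apply List.ne_nil_of_length_pos; rw [List.length_drop]; omega
      obtain ⟨A0, B0, hI, hpA, hpB⟩ := exists_interl L A B hp
      have hnd' : (A ++ B).Nodup := hp.nodup_iff.1 hnd
      have hndA := hnd'.of_append_left
      have hndB := hnd'.of_append_right
      have hd : Disjoint A.toFinset B.toFinset := by
        rw [List.disjoint_toFinset_iff_disjoint]
        exact List.disjoint_of_nodup_append hnd'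
      have hlen : L.length = A.length + B.length := by rw [hp.length_eq, List.length_append]
      have tA : A0.toFinset = A.toFinset := List.toFinset_eq_of_perm _ _ hpA
      have tB : B0.toFinset = B.toFinset := List.toFinset_eq_of_perm _ _ hpB
      have cA : A.toFinset.card = A.length := List.toFinset_card_of_nodup hndA
      have cB : B.toFinset.card = B.length := List.toFinset_card_of_nodup hndB
      have tL : L.toFinset = A.toFinset ∪ B.toFinset := by
        rw [List.toFinset_eq_of_perm _ _ hp, List.toFinset_append]
      have hA0 : A0 ≠ [] := by rintro rfl; exact hA hpA.nil_eq.symm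
      have hB0 : B0 ≠ [] := by rintro rfl; exact hB hpB.nil_eq.symm
      have hAne : A.toFinset.Nonempty := by simpa using hA
      have hBne : B.toFinset.Nonempty := by simpa using hB
      have cAB : (A.toFinset ∪ B.toFinset).card ≤ m := by
        rw [Finset.card_union_of_disjoint hd]; omega
      have s1 := interl_eqv V m hV hI hnd hm hA0 hB0 G hG
      have s4 := interl_eqv V m hV (interl_append A B) hnd' (by rw [← hp.length_eq]; exact hm)
        hA hB G (by rw [List.toFinset_append, ← tL]; exact hG)
      rw [tA, tB] at s1
      rw [tL] at hG
      have s2 := ih A0 A (hpA.nodup_iff.2 hndA) hpA (by rw [hpA.length_eq]; exact hAl)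
        (by rw [hpA.length_eq]; omega)
        (G ∪ (ctr V A.toFinset B.toFinset ∪ comb V B0)) (by
          rw [tA]
          refine Fr.union (hG.mono Finset.subset_union_left) (Fr.union ?_ ?_)
          · exact Fr.ctr hV hAne hBne hd cAB
          · exact Fr.comb hV (by rw [tB]; exact hd) (by omega) (by rw [tB]; omega))
      have s3 := ih B0 B (hpB.nodup_iff.2 hndB) hpB (by rw [hpB.length_eq]; exact hBl)
        (by rw [hpB.length_eq]; omega)
        (G ∪ (ctr V A.toFinset B.toFinset ∪ comb V A)) (by
          rw [tB]
          refine Fr.union (hG.mono Finset.subset_union_right) (Fr.union ?_ ?_)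
          · rw [ctr_comm]
            exact Fr.ctr hV hBne hAne hd.symm (by rw [Finset.union_comm]; exact cAB)
          · exact Fr.comb hV hd.symm (by omega) (by omega))
      have e1 : G ∪ (ctr V A.toFinset B.toFinset ∪ comb V B0) ∪ comb V A0 =
          G ∪ (ctr V A.toFinset B.toFinset ∪ (comb V A0 ∪ comb V B0)) := by ac_rfl
      have e2 : G ∪ (ctr V A.toFinset B.toFinset ∪ comb V B0) ∪ comb V A =
          G ∪ (ctr V A.toFinset B.toFinset ∪ comb V A) ∪ comb V B0 := by ac_rfl
      have e3 : G ∪ (ctr V A.toFinset B.toFinset ∪ comb V A) ∪ comb V B =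
          G ∪ (ctr V A.toFinset B.toFinset ∪ (comb V A ∪ comb V B)) := by ac_rfl
      rw [e1, e2] at s2
      rw [e3] at s3
      have := ((s1.symm.trans s2).trans s3).trans s4
      refine this.mono (le_of_eq ?_)
      rw [hpA.length_eq, hpB.length_eq, List.length_append, hlen]
      ring

end Combs

/-! ### Names and the linear encoding -/

section Names

variable {n : ℕ}

open Classical in
/-- The literal attached to a set of leaves. -/
noncomputable def nameV (x : Fin n → Lit ℕ) (ψ : Finset (Fin n) → ℕ) (S : Finset (Fin n)) :
    Lit ℕ :=
  if h : ∃ i, S = {i} then x h.choose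
  else if h : ∃ i, S = Finset.univ.erase i then x h.choose
  else (ψ S, true)

theorem nameV_singleton (x : Fin n → Lit ℕ) (ψ : Finset (Fin n) → ℕ) (i : Fin n) :
    nameV x ψ {i} = x i := by
  have h : ∃ j, ({i} : Finset (Fin n)) = {j} := ⟨i, rfl⟩
  unfold nameV
  rw [dif_pos h, ← Finset.singleton_inj.1 h.choose_spec]

theorem card_erase_fin (i : Fin n) : (Finset.univ.erase i : Finset (Fin n)).card = n - 1 := by
  rw [Finset.card_erase_of_mem (Finset.mem_univ _), Finset.card_univ, Fintype.card_fin]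

theorem nameV_erase (hn : 4 ≤ n) (x : Fin n → Lit ℕ) (ψ : Finset (Fin n) → ℕ) (i : Fin n) :
    nameV x ψ (Finset.univ.erase i) = x i := by
  have h0 : ¬ ∃ j, (Finset.univ.erase i : Finset (Fin n)) = {j} := by
    rintro ⟨j, hj⟩
    have := card_erase_fin i
    rw [hj, Finset.card_singleton] at this
    omega
  have h : ∃ j, (Finset.univ.erase i : Finset (Fin n)) = Finset.univ.erase j := ⟨i, rfl⟩
  unfold nameV
  rw [dif_neg h0, dif_pos h]
  congr 1
  have hs := h.choose_spec
  by_contra hne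
  have : i ∈ (Finset.univ.erase h.choose : Finset (Fin n)) :=
    Finset.mem_erase.2 ⟨fun h' => hne h'.symm, Finset.mem_univ _⟩
  rw [← hs] at this
  simp at this

theorem nameV_mid (x : Fin n → Lit ℕ) (ψ : Finset (Fin n) → ℕ) (S : Finset (Fin n))
    (h2 : 2 ≤ S.card) (hS : S.card < n - 1) : nameV x ψ S = (ψ S, true) := by
  have h0 : ¬ ∃ j, S = {j} := by
    rintro ⟨j, rfl⟩
    rw [Finset.card_singleton] at h2
    omega
  have h1 : ¬ ∃ j, S = Finset.univ.erase j := by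
    rintro ⟨j, rfl⟩
    rw [card_erase_fin] at hS
    omega
  unfold nameV
  rw [dif_neg h0, dif_neg h1]

theorem nameV_congr (x : Fin n → Lit ℕ) (ψ ψ' : Finset (Fin n) → ℕ) (S : Finset (Fin n))
    (h : ψ S = ψ' S) : nameV x ψ S = nameV x ψ' S := by
  unfold nameV
  rw [h]

theorem exists_erase_of_card (S : Finset (Fin n)) (hn : 4 ≤ n) (hS : S.card = n - 1) :
    ∃ i, S = Finset.univ.erase i := by
  have h1 : Sᶜ.card = 1 := by
    rw [Finset.card_compl, Fintype.card_fin, hS]; omega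
  obtain ⟨i, hi⟩ := Finset.card_eq_one.1 h1
  refine ⟨i, ?_⟩
  ext j
  have : j ∈ Sᶜ ↔ j = i := by rw [hi, Finset.mem_singleton]
  rw [Finset.mem_compl] at this
  simp only [Finset.mem_erase, Finset.mem_univ, and_true]
  tauto

theorem nameV_good (hn : 4 ≤ n) (x : Fin n → Lit ℕ) (ψ : Finset (Fin n) → ℕ)
    (hinj : ∀ R R' : Finset (Fin n), 2 ≤ R.card → R.card < n - 1 → 2 ≤ R'.card →
      R'.card < n - 1 → ψ R' = ψ R → R' = R)
    (hx : ∀ R : Finset (Fin n), ∀ i, 2 ≤ R.card → R.card < n - 1 → ψ R ≠ (x i).1) :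
    Good (nameV x ψ) (n - 1) := by
  intro R R' h1 h2 h3 h4 h5
  rw [nameV_mid x ψ R h1 h2] at h5
  have h6 := Finset.card_pos.2 h3
  by_cases c1 : R'.card = 1
  · obtain ⟨i, rfl⟩ := Finset.card_eq_one.1 c1
    rw [nameV_singleton] at h5
    exact (hx R i h1 h2 h5.symm).elim
  · by_cases c2 : R'.card = n - 1
    · obtain ⟨i, rfl⟩ := exists_erase_of_card R' hn c2
      rw [nameV_erase hn] at h5
      exact (hx R i h1 h2 h5.symm).elim
    · rw [nameV_mid x ψ R' (by omega) (by omega)] at h5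
      exact hinj R R' h1 h2 (by omega) (by omega) h5

/-- The first `k` leaves of the order `σ`, latest first. -/
def revL [NeZero n] (σ : Equiv.Perm (Fin n)) : ℕ → List (Fin n)
  | 0 => []
  | k + 1 => σ (Fin.ofNat n k) :: revL σ k

variable [NeZero n]

theorem revL_length (σ : Equiv.Perm (Fin n)) (k : ℕ) : (revL σ k).length = k := by
  induction k with
  | zero => rfl
  | succ k ih => simp [revL, ih]

theorem mem_revL (σ : Equiv.Perm (Fin n)) (k : ℕ) (i : Fin n) :
    i ∈ revL σ k ↔ ∃ j < k, i = σ (Fin.ofNat n j) := by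
  induction k with
  | zero => simp [revL]
  | succ k ih =>
    rw [revL, List.mem_cons, ih]
    constructor
    · rintro (h | ⟨j, h1, h2⟩)
      · exact ⟨k, by omega, h⟩
      · exact ⟨j, by omega, h2⟩
    · rintro ⟨j, h1, h2⟩
      by_cases hj : j = k
      · left; rw [h2, hj]
      · right; exact ⟨j, by omega, h2⟩

theorem sigma_inj (σ : Equiv.Perm (Fin n)) {j k : ℕ} (hj : j < n) (hk : k < n)
    (h : σ (Fin.ofNat n j) = σ (Fin.ofNat n k)) : j = k := by
  have h1 := σ.injective h
  have h2 := congrArg Fin.val h1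
  simpa [Fin.ofNat, Nat.mod_eq_of_lt hj, Nat.mod_eq_of_lt hk] using h2

theorem notMem_revL (σ : Equiv.Perm (Fin n)) {j k : ℕ} (hjk : j ≤ k) (hk : k < n) :
    σ (Fin.ofNat n k) ∉ revL σ j := by
  rw [mem_revL]
  rintro ⟨i, h1, h2⟩
  have := sigma_inj σ hk (by omega) h2
  omega

theorem revL_nodup (σ : Equiv.Perm (Fin n)) (k : ℕ) (hk : k ≤ n) : (revL σ k).Nodup := by
  induction k with
  | zero => exact List.nodup_nil
  | succ k ih =>
    rw [revL, List.nodup_cons]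
    exact ⟨notMem_revL σ le_rfl (by omega), ih (by omega)⟩

theorem revL_card (σ : Equiv.Perm (Fin n)) (k : ℕ) (hk : k ≤ n) :
    (revL σ k).toFinset.card = k := by
  rw [List.toFinset_card_of_nodup (revL_nodup σ k hk), revL_length]

theorem revL_full (σ : Equiv.Perm (Fin n)) (hn : 4 ≤ n) :
    (revL σ (n - 1)).toFinset = Finset.univ.erase (σ (Fin.ofNat n (n - 1))) := by
  apply Finset.eq_of_subset_of_card_le
  · intro i hi
    rw [Finset.mem_erase]
    refine ⟨?_, Finset.mem_univ _⟩
    rintro rfl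
    rw [List.mem_toFinset] at hi
    exact notMem_revL σ le_rfl (by omega) hi
  · rw [card_erase_fin, revL_card σ _ (by omega)]

theorem comb_revL (V : Finset (Fin n) → Lit ℕ) (σ : Equiv.Perm (Fin n)) (k : ℕ) :
    comb V (revL σ (k + 1)) = (Finset.range k).biUnion
      (fun j => ctr V (revL σ (j + 1)).toFinset {σ (Fin.ofNat n (j + 1))}) := by
  induction k with
  | zero => simp [revL, comb]
  | succ k ih =>
    rw [revL, comb_cons _ _ _ (by simp [revL]), ih, Finset.range_add_one,
      Finset.biUnion_insert]

theorem getD_ofFn (x : Fin n → Lit ℕ) (σ : Equiv.Perm (Fin n)) (k : ℕ) (hk : k < n)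
    (d : Lit ℕ) : (List.ofFn (fun i => x (σ i))).getD k d = x (σ (Fin.ofNat n k)) := by
  rw [List.getD_eq_getElem _ _ (by simpa using hk), List.getElem_ofFn]
  congr 2
  apply Fin.ext
  simp [Fin.ofNat, Nat.mod_eq_of_lt hk]

theorem parity_eq_comb (hn : 4 ≤ n) (x : Fin n → Lit ℕ) (σ : Equiv.Perm (Fin n)) (s : ℕ → ℕ)
    (V : Finset (Fin n) → Lit ℕ) (h1 : ∀ i, V {i} = x i)
    (h2 : ∀ j < n - 3, V (revL σ (j + 2)).toFinset = (s j, true))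
    (h3 : V (revL σ (n - 1)).toFinset = x (σ (Fin.ofNat n (n - 1)))) :
    ParityCNF (List.ofFn (fun i => x (σ i))) s = comb V (revL σ (n - 1)) := by
  obtain ⟨m, rfl⟩ : ∃ m, n = m + 4 := ⟨n - 4, by omega⟩
  have := comb_revL V σ (m + 2)
  rw [show m + 4 - 1 = m + 2 + 1 by omega, this]
  unfold ParityCNF
  rw [List.length_ofFn]
  apply Finset.biUnion_congr (by simp)
  intro j hj
  rw [Finset.mem_range] at hj
  have eS : (revL σ (j + 1)).toFinset ∪ {σ (Fin.ofNat (m + 4) (j + 1))} =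
      (revL σ (j + 2)).toFinset := by
    have h0 : revL σ (j + 2) = σ (Fin.ofNat (m + 4) (j + 1)) :: revL σ (j + 1) := rfl
    rw [h0, List.toFinset_cons, Finset.insert_eq, Finset.union_comm]
  unfold ctr xor3 parityCtr
  rw [eS, h1, List.length_ofFn]
  congr 1
  by_cases hj0 : j = 0
  · subst hj0
    rw [if_pos rfl, getD_ofFn x σ 0 (by omega), getD_ofFn x σ 1 (by omega), h2 0 (by omega)]
    have : (revL σ (0 + 1)).toFinset = {σ (Fin.ofNat (m + 4) 0)} := by
      simp [revL]
    rw [this, h1]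
  · rw [if_neg hj0]
    have e1 : V (revL σ (j + 1)).toFinset = (s (j - 1), true) := by
      have := h2 (j - 1) (by omega)
      rwa [show j - 1 + 2 = j + 1 by omega] at this
    by_cases hj1 : j < m + 4 - 3
    · rw [if_pos hj1, getD_ofFn x σ _ (by omega), h2 j hj1, e1]
    · have hj2 : j = m + 1 := by omega
      subst hj2
      rw [if_neg hj1, getD_ofFn x σ _ (by omega), getD_ofFn x σ _ (by omega), e1]
      have h3' : V (revL σ (m + 1 + 2)).toFinset = x (σ (Fin.ofNat (m + 4) (m + 4 - 1))) := h3
      rw [h3']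
      rfl

theorem comb_congr (V V' : Finset (Fin n) → Lit ℕ) (p : Fin n) (h1 : ∀ i, V {i} = V' {i})
    (h2 : ∀ S, p ∈ S → V S = V' S) (N : List (Fin n)) :
    comb V (N ++ [p]) = comb V' (N ++ [p]) := by
  induction N with
  | nil => simp [comb]
  | cons y N ih =>
    rw [List.cons_append, comb_cons _ _ _ (by simp), comb_cons _ _ _ (by simp), ih]
    congr 1
    unfold ctr
    rw [h1, h2 _ (by simp), h2 _ (by simp)]

open Classical in
/-- The names of the prefixes of `σ` are given by `s`, the others by `φ`. -/
noncomputable def namePsi (σ : Equiv.Perm (Fin n)) (s : ℕ → ℕ) (φ : Finset (Fin n) → ℕ)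
    (S : Finset (Fin n)) : ℕ :=
  if h : ∃ j, j < n - 3 ∧ S = (revL σ (j + 2)).toFinset then s h.choose else φ S

theorem namePsi_initial (hn : 4 ≤ n) (σ : Equiv.Perm (Fin n)) (s : ℕ → ℕ)
    (φ : Finset (Fin n) → ℕ) (j : ℕ) (hj : j < n - 3) :
    namePsi σ s φ (revL σ (j + 2)).toFinset = s j := by
  have h : ∃ k, k < n - 3 ∧ (revL σ (j + 2)).toFinset = (revL σ (k + 2)).toFinset :=
    ⟨j, hj, rfl⟩
  unfold namePsi
  rw [dif_pos h]
  congr 1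
  have h1 := h.choose_spec.1
  have h2 := congrArg Finset.card h.choose_spec.2
  rw [revL_card σ _ (by omega), revL_card σ _ (by omega)] at h2
  omega

theorem namePsi_cases (hn : 4 ≤ n) (σ : Equiv.Perm (Fin n)) (s : ℕ → ℕ)
    (φ : Finset (Fin n) → ℕ) (S : Finset (Fin n)) :
    (∃ j, j < n - 3 ∧ S = (revL σ (j + 2)).toFinset ∧ namePsi σ s φ S = s j) ∨
      ((¬ ∃ j, j < n - 3 ∧ S = (revL σ (j + 2)).toFinset) ∧ namePsi σ s φ S = φ S) := by
  by_cases h : ∃ j, j < n - 3 ∧ S = (revL σ (j + 2)).toFinset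
  · obtain ⟨j, hj, rfl⟩ := h
    exact Or.inl ⟨j, hj, rfl, namePsi_initial hn σ s φ j hj⟩
  · right
    refine ⟨h, ?_⟩
    unfold namePsi
    rw [dif_neg h]

theorem parity_to_comb (hn : 4 ≤ n) (x : Fin n → Lit ℕ) (σ : Equiv.Perm (Fin n)) (s : ℕ → ℕ)
    (F : CNF ℕ) (φ : Finset (Fin n) → ℕ) (k : ℕ) (hk : n ≤ 2 ^ k)
    (hs : ∀ j k, j < n - 3 → k < n - 3 → s j = s k → j = k)
    (hsF : ∀ j, j < n - 3 → s j ∉ cnfVars F)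
    (hsx : ∀ j i, j < n - 3 → s j ≠ (x i).1)
    (hφ : Function.Injective φ) (hφF : ∀ S, φ S ∉ cnfVars F) (hφx : ∀ S i, φ S ≠ (x i).1)
    (hφs : ∀ S j, j < n - 3 → φ S ≠ s j)
    (M : List (Fin n)) (hM : (revL σ (n - 1)).Perm M) :
    Steps (192 * k * n) (F ∪ ParityCNF (List.ofFn (fun i => x (σ i))) s)
      (F ∪ comb (nameV x φ) M) := by
  have g2 : Good (nameV x φ) (n - 1) :=
    nameV_good hn x φ (fun R R' _ _ _ _ h => hφ h) (fun R i _ _ => hφx R i)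
  have g1 : Good (nameV x (namePsi σ s φ)) (n - 1) := by
    apply nameV_good hn x
    · intro R R' _ _ _ _ h
      rcases namePsi_cases hn σ s φ R with ⟨j, hj, e1, e2⟩ | ⟨e1, e2⟩ <;>
      rcases namePsi_cases hn σ s φ R' with ⟨j', hj', e1', e2'⟩ | ⟨e1', e2'⟩ <;>
      rw [e2, e2'] at h
      · rw [e1, e1', hs _ _ hj' hj h]
      · exact (hφs _ _ hj h).elim
      · exact (hφs _ _ hj' h.symm).elim
      · exact hφ h
    · intro R i _ _
      rcases namePsi_cases hn σ s φ R with ⟨j, hj, e1, e2⟩ | ⟨e1, e2⟩ <;> rw [e2]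
      · exact hsx j i hj
      · exact hφx R i
  have e0 : ParityCNF (List.ofFn (fun i => x (σ i))) s =
      comb (nameV x (namePsi σ s φ)) (revL σ (n - 1)) := by
    apply parity_eq_comb hn
    · exact nameV_singleton x _
    · intro j hj
      rw [nameV_mid, namePsi_initial hn σ s φ j hj]
      · rw [revL_card σ _ (by omega)]; omega
      · rw [revL_card σ _ (by omega)]; omega
    · rw [revL_full σ hn, nameV_erase hn]
  have hcard : ∀ L : List (Fin n), L.Perm (revL σ (n - 1)) → L.toFinset.card = n - 1 := by
    intro L hL
    rw [List.toFinset_eq_of_perm _ _ hL, revL_card σ _ (by omega)]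
  have f1 : ∀ L : List (Fin n), L.Perm (revL σ (n - 1)) →
      Fr (nameV x (namePsi σ s φ)) L.toFinset F := by
    intro L hL R hR h2
    have h3 := Finset.card_lt_card hR
    rw [hcard L hL] at h3
    rw [nameV_mid x _ R h2 h3]
    rcases namePsi_cases hn σ s φ R with ⟨j, hj, e1, e2⟩ | ⟨e1, e2⟩ <;> rw [e2]
    · exact hsF j hj
    · exact hφF R
  have f2 : ∀ L : List (Fin n), L.Perm (revL σ (n - 1)) →
      Fr (nameV x φ) L.toFinset F := by
    intro L hL R hR h2
    have h3 := Finset.card_lt_card hR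
    rw [hcard L hL] at h3
    rw [nameV_mid x _ R h2 h3]
    exact hφF R
  let p := σ (Fin.ofNat n (n - 2))
  have hp : (revL σ (n - 1)).Perm (revL σ (n - 2) ++ [p]) := by
    have : revL σ (n - 1) = p :: revL σ (n - 2) := by
      rw [show n - 1 = (n - 2) + 1 by omega]; rfl
    rw [this]
    exact (List.perm_append_singleton _ _).symm
  have hnd := revL_nodup σ (n - 1) (by omega)
  have hlen := revL_length σ (n - 1)
  have s1 := sort_eqv _ _ g1 k _ _ hnd hp (by omega) (by omega) F (f1 _ (List.Perm.refl _))
  have s2 := sort_eqv _ _ g2 k _ _ (hp.nodup_iff.1 hnd) (hp.symm.trans hM)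
    (by rw [← hp.length_eq]; omega) (by rw [← hp.length_eq]; omega) F (f2 _ hp.symm)
  have ec : comb (nameV x (namePsi σ s φ)) (revL σ (n - 2) ++ [p]) =
      comb (nameV x φ) (revL σ (n - 2) ++ [p]) := by
    apply comb_congr
    · intro i; rw [nameV_singleton, nameV_singleton]
    · intro S hpS
      apply nameV_congr
      rcases namePsi_cases hn σ s φ S with ⟨j, hj, e1, e2⟩ | ⟨e1, e2⟩
      · rw [e1, List.mem_toFinset] at hpS
        exact (notMem_revL σ (by omega) (by omega) hpS).elim
      · exact e2
  rw [e0]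
  rw [ec] at s1
  refine (s1.trans s2).mono ?_
  rw [← hp.length_eq, hlen]
  have : 96 * k * (n - 1) ≤ 96 * k * n := Nat.mul_le_mul_left _ (by omega)
  have e : 192 * k * n = 96 * k * n + 96 * k * n := by ring
  omega

theorem reorder_nat (hn : 4 ≤ n) (σ1 σ2 : Equiv.Perm (Fin n)) (x : Fin n → Lit ℕ)
    (s t : ℕ → ℕ) (F : CNF ℕ) (k : ℕ) (hk : n ≤ 2 ^ k)
    (hs : ∀ j k, j < n - 3 → k < n - 3 → s j = s k → j = k)
    (ht : ∀ j k, j < n - 3 → k < n - 3 → t j = t k → j = k)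
    (hF : ∀ j, j < n - 3 → s j ∉ cnfVars F ∧ t j ∉ cnfVars F)
    (hx : ∀ j i, j < n - 3 → s j ≠ (x i).1 ∧ t j ≠ (x i).1) :
    Steps (384 * k * n) (F ∪ ParityCNF (List.ofFn (fun i => x (σ1 i))) s)
      (F ∪ ParityCNF (List.ofFn (fun i => x (σ2 i))) t) := by
  obtain ⟨b, hbF, hbx, hbs, hbt⟩ : ∃ b : ℕ, (∀ v ∈ cnfVars F, v < b) ∧ (∀ i, (x i).1 < b) ∧
      (∀ j < n - 3, s j < b) ∧ (∀ j < n - 3, t j < b) := by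
    let U : Finset ℕ := (F.sup id).image Prod.fst ∪ Finset.univ.image (fun i => (x i).1) ∪
      (Finset.range (n - 3)).image s ∪ (Finset.range (n - 3)).image t
    have hU : ∀ v ∈ U, v < U.sup id + 1 := fun v hv =>
      Nat.lt_succ_of_le (Finset.le_sup (f := id) hv)
    refine ⟨U.sup id + 1, ?_, ?_, ?_, ?_⟩
    · rintro v ⟨C, hC, d, hd⟩
      apply hU
      simp only [U, Finset.mem_union]
      exact Or.inl (Or.inl (Or.inl (Finset.mem_image.2
        ⟨(v, d), Finset.mem_sup.2 ⟨C, hC, hd⟩, rfl⟩)))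
    · intro i
      apply hU
      simp only [U, Finset.mem_union]
      exact Or.inl (Or.inl (Or.inr (Finset.mem_image.2 ⟨i, Finset.mem_univ _, rfl⟩)))
    · intro j hj
      apply hU
      simp only [U, Finset.mem_union]
      exact Or.inl (Or.inr (Finset.mem_image.2 ⟨j, Finset.mem_range.2 hj, rfl⟩))
    · intro j hj
      apply hU
      simp only [U, Finset.mem_union]
      exact Or.inr (Finset.mem_image.2 ⟨j, Finset.mem_range.2 hj, rfl⟩)
  let φ : Finset (Fin n) → ℕ := fun S => b + Encodable.encode S
  have hφ : Function.Injective φ := by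
    intro S S' h
    exact Encodable.encode_injective (Nat.add_left_cancel h)
  have hφb : ∀ S, b ≤ φ S := fun S => Nat.le_add_right _ _
  have hφF : ∀ S, φ S ∉ cnfVars F := fun S h => absurd (hbF _ h) (not_lt.2 (hφb S))
  have hφx : ∀ S i, φ S ≠ (x i).1 := fun S i h => by
    have := hbx i; have := hφb S; omega
  have hφs : ∀ S j, j < n - 3 → φ S ≠ s j := fun S j hj h => by
    have := hbs j hj; have := hφb S; omega
  have hφt : ∀ S j, j < n - 3 → φ S ≠ t j := fun S j hj h => by
    have := hbt j hj; have := hφb S; omega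
  have c1 := parity_to_comb hn x σ1 s F φ k hk hs (fun j hj => (hF j hj).1)
    (fun j i hj => (hx j i hj).1) hφ hφF hφx hφs
  have c2 := parity_to_comb hn x σ2 t F φ k hk ht (fun j hj => (hF j hj).2)
    (fun j i hj => (hx j i hj).2) hφ hφF hφx hφt
  have nd1 := revL_nodup σ1 (n - 1) (by omega)
  have nd2 := revL_nodup σ2 (n - 1) (by omega)
  have full1 := revL_full σ1 hn
  have full2 := revL_full σ2 hn
  generalize σ1 (Fin.ofNat n (n - 1)) = o1 at full1
  generalize σ2 (Fin.ofNat n (n - 1)) = o2 at full2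
  have hfin : ∃ M1 M2, (revL σ1 (n - 1)).Perm M1 ∧ (revL σ2 (n - 1)).Perm M2 ∧
      comb (nameV x φ) M1 = comb (nameV x φ) M2 := by
    by_cases ho : o1 = o2
    · refine ⟨revL σ2 (n - 1), revL σ2 (n - 1), ?_, List.Perm.refl _, rfl⟩
      apply List.perm_of_nodup_nodup_toFinset_eq nd1 nd2
      rw [full1, full2, ho]
    · let S : Finset (Fin n) := (Finset.univ.erase o1).erase o2
      have tS : S.toList.toFinset = S := Finset.toList_toFinset S
      have i1 : insert o2 S = Finset.univ.erase o1 := by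
        apply Finset.insert_erase
        exact Finset.mem_erase.2 ⟨fun h => ho h.symm, Finset.mem_univ _⟩
      have i2 : insert o1 S = Finset.univ.erase o2 := by
        have : S = (Finset.univ.erase o2).erase o1 := Finset.erase_right_comm
        rw [this]
        apply Finset.insert_erase
        exact Finset.mem_erase.2 ⟨ho, Finset.mem_univ _⟩
      have hS : S.toList ≠ [] := by
        intro h
        have h0 : S = ∅ := Finset.toList_eq_nil.1 h
        have h1 := congrArg Finset.card i1
        rw [h0, card_erase_fin] at h1
        simp at h1
        omega
      refine ⟨o2 :: S.toList, o1 :: S.toList, ?_, ?_, ?_⟩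
      · apply List.perm_of_nodup_nodup_toFinset_eq nd1
        · rw [List.nodup_cons]
          exact ⟨by simp [S], Finset.nodup_toList S⟩
        · rw [full1, List.toFinset_cons, tS, i1]
      · apply List.perm_of_nodup_nodup_toFinset_eq nd2
        · rw [List.nodup_cons]
          exact ⟨by simp [S], Finset.nodup_toList S⟩
        · rw [full2, List.toFinset_cons, tS, i2]
      · rw [comb_cons _ _ _ hS, comb_cons _ _ _ hS, tS]
        congr 1
        unfold ctr
        rw [Finset.union_comm, ← Finset.insert_eq, i1, Finset.union_comm, ← Finset.insert_eq, i2,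
          nameV_erase hn, nameV_erase hn, nameV_singleton, nameV_singleton, xor3_swap23]
  obtain ⟨M1, M2, p1, p2, he⟩ := hfin
  have d1 := c1 M1 p1
  have d2 := c2 M2 p2
  rw [he] at d1
  refine (d1.trans d2.symm).mono (le_of_eq ?_)
  ring

end Names

/-- There is a constant `K` such that for every `n ≥ 4`, permutations
`σ₁, σ₂` of `{1,…,n}`, an ordered set `x` of `n` literals, and disjoint sets `S`, `T` of
Tseitin variables (given by `s, t` on indices `< n - 3`) none of whose variables occur
in `F` or in `X`, the formula `F ∧ Parity(X, S, σ₁)` can be transformed into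
`F ∧ Parity(X, T, σ₂)` by a DRAT derivation with at most `K·n·log n` steps. -/
theorem drat_reordering :
    ∃ K : ℝ, ∀ n : ℕ, 4 ≤ n → ∀ (σ1 σ2 : Equiv.Perm (Fin n)) (x : Fin n → Lit ℕ)
      (s t : ℕ → ℕ) (F : CNF ℕ),
      (∀ j k, j < n - 3 → k < n - 3 → s j = s k → j = k) →
      (∀ j k, j < n - 3 → k < n - 3 → t j = t k → j = k) →
      (∀ j k, j < n - 3 → k < n - 3 → s j ≠ t k) →
      (∀ j, j < n - 3 → s j ∉ cnfVars F ∧ t j ∉ cnfVars F) →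
      (∀ j i, j < n - 3 → s j ≠ (x i).1 ∧ t j ≠ (x i).1) →
      ∃ Fs : List (CNF ℕ),
        List.Chain' DRATStep Fs ∧
        Fs.head? = some (F ∪ ParityCNF (List.ofFn (fun i => x (σ1 i))) s) ∧
        Fs.getLast? = some (F ∪ ParityCNF (List.ofFn (fun i => x (σ2 i))) t) ∧
        (Fs.length : ℝ) - 1 ≤ K * n * Real.log n := by
  refine ⟨1536, ?_⟩
  intro n hn σ1 σ2 x s t F hs ht _ hF hx
  have : NeZero n := ⟨by omega⟩
  have hk : n ≤ 2 ^ (Nat.log 2 n + 1) := (Nat.lt_pow_succ_log_self (by norm_num) n).le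
  obtain ⟨Fs, h1, h2, h3, h4⟩ :=
    (reorder_nat hn σ1 σ2 x s t F (Nat.log 2 n + 1) hk hs ht hF hx).toList
  refine ⟨Fs, h1, h2, h3, ?_⟩
  have h5 : (Fs.length : ℝ) - 1 ≤ 384 * ((Nat.log 2 n : ℝ) + 1) * n := by
    have : (Fs.length : ℝ) ≤ ((384 * (Nat.log 2 n + 1) * n + 1 : ℕ) : ℝ) := by exact_mod_cast h4
    push_cast at this
    linarith
  have hn' : (4 : ℝ) ≤ n := by exact_mod_cast hn
  have l2 : (0.6931471803 : ℝ) < Real.log 2 := Real.log_two_gt_d9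
  have h6 : (Nat.log 2 n : ℝ) * Real.log 2 ≤ Real.log n := by
    rw [← Real.log_pow]
    apply Real.log_le_log (by positivity)
    exact_mod_cast Nat.pow_log_le_self 2 (by omega)
  have h7 : 2 * Real.log 2 ≤ Real.log n := by
    have : Real.log ((2 : ℝ) ^ 2) ≤ Real.log n :=
      Real.log_le_log (by norm_num) (by norm_num; exact hn)
    rw [Real.log_pow] at this
    exact_mod_cast this
  have h8 : (Nat.log 2 n : ℝ) + 1 ≤ 4 * Real.log n := by
    have h0 : (0 : ℝ) ≤ Nat.log 2 n := Nat.cast_nonneg _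
    nlinarith
  calc (Fs.length : ℝ) - 1 ≤ 384 * ((Nat.log 2 n : ℝ) + 1) * n := h5
    _ ≤ 384 * (4 * Real.log n) * n := by gcongr
    _ = 1536 * n * Real.log n := by ring
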